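/- Let f be a smooth function on J^r, let l ∈ Fin n, σ ∈ Fin m, and let K be a multi-index with |K| ≤ r + 1. Regarding d_l f as a smooth function on J^{r+1}: if K(l) ≥ 1 then E^K_σ(d_l f) = E^{K−e_l}_σ(f), and if K(l) = 0 then E^K_σ(d_l f) = 0. In particular E_σ(d_l f) = 0: the Euler–Lagrange expressions annihilate formal derivatives. -/

import Mathlib

open scoped BigOperators

namespace JetVar

/-- Multi-indices on `Fin n` of degree at most `r`. -/
abbrev MD (n r : ℕ) : Type := {J : Fin n → ℕ // (∑ i, J i) ≤ r}

noncomputable instance (n r : ℕ) : Fintype (MD n r) :=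
  Fintype.ofInjective
    (fun J : MD n r => fun i : Fin n =>
      (⟨J.1 i, Nat.lt_succ_of_le ((Finset.single_le_sum
        (fun j _ => Nat.zero_le (J.1 j)) (Finset.mem_univ i)).trans J.2)⟩ : Fin (r+1)))
    (fun _a _b h => Subtype.ext (funext fun i => congrArg Fin.val (congrFun h i)))

/-- Index set for the `y` coordinates of the `r`-th order jet space. -/
abbrev JIdx (n m r : ℕ) : Type := Fin m × MD n r

/-- The `r`-th order jet coordinate space. -/
abbrev Jet (n m r : ℕ) : Type := ((Fin n) → ℝ) × (JIdx n m r → ℝ)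

variable {n m : ℕ}

/-- The coordinate `x^i`. -/
def xc (i : Fin n) {r : ℕ} (p : Jet n m r) : ℝ := p.1 i

/-- The coordinate `y^σ_J` (with the convention that it is `0` for `|J| > r`). -/
def yc (σ : Fin m) (J : Fin n → ℕ) {r : ℕ} (p : Jet n m r) : ℝ :=
  if h : (∑ i, J i) ≤ r then p.2 (σ, ⟨J, h⟩) else 0

/-- Partial derivative along the coordinate direction `x^i`. -/
noncomputable def pdX (i : Fin n) {r : ℕ} (f : Jet n m r → ℝ) (p : Jet n m r) : ℝ :=
  fderiv ℝ f p (Pi.single i 1, 0)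

/-- Partial derivative along the coordinate direction `y^σ_J`
(by convention `0` for `|J| > r`). -/
noncomputable def pdY (σ : Fin m) (J : Fin n → ℕ) {r : ℕ} (f : Jet n m r → ℝ)
    (p : Jet n m r) : ℝ :=
  if h : (∑ i, J i) ≤ r then fderiv ℝ f p (0, Pi.single (σ, (⟨J, h⟩ : MD n r)) 1) else 0

/-- Projection `J^s → J^r` for `r ≤ s`, forgetting higher order coordinates. -/
def projJet {r s : ℕ} (h : r ≤ s) (p : Jet n m s) : Jet n m r :=
  (p.1, fun q => p.2 (q.1, ⟨q.2.1, q.2.2.trans h⟩))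

/-- `J + e_i`. -/
def addE (J : Fin n → ℕ) (i : Fin n) : Fin n → ℕ := fun j => J j + (if j = i then 1 else 0)

/-- `J - e_i` (truncated subtraction). -/
def subE (J : Fin n → ℕ) (i : Fin n) : Fin n → ℕ := fun j => J j - (if j = i then 1 else 0)

/-- The `i`-th formal (total) derivative of a function on `J^r`, a function on `J^{r+1}`. -/
noncomputable def formalD (i : Fin n) {r : ℕ} (f : Jet n m r → ℝ) (p : Jet n m (r+1)) : ℝ :=
  pdX i f (projJet (Nat.le_succ r) p)
    + ∑ q : JIdx n m r, yc q.1 (addE q.2.1 i) p * pdY q.1 q.2.1 f (projJet (Nat.le_succ r) p)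

/-- Iterated formal derivatives along a list of directions. -/
noncomputable def formalDL {r : ℕ} : (l : List (Fin n)) → (Jet n m r → ℝ) →
    (Jet n m (r + l.length) → ℝ)
  | [], f => f
  | i :: l, f => formalD i (formalDL l f)

/-- The canonical list of directions attached to a multi-index
(each `i` repeated `J i` times, in increasing order of `i`). -/
def mlist (J : Fin n → ℕ) : List (Fin n) :=
  (List.finRange n).flatMap (fun i => List.replicate (J i) i)

lemma mlist_length (J : Fin n → ℕ) : (mlist J).length = ∑ i, J i := by
  rw [mlist, List.length_flatMap]
  simp only [Function.comp_def, List.length_replicate]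
  rw [Fin.sum_univ_def]

/-- The iterated formal derivative `d_I`, applying each `d_i` exactly `I i` times
(in increasing order of `i`); a function on `J^{r+|I|}`. -/
noncomputable def formalDI (I : Fin n → ℕ) {r : ℕ} (f : Jet n m r → ℝ)
    (p : Jet n m (r + ∑ i, I i)) : ℝ :=
  formalDL (mlist I) f (projJet (le_of_eq (by rw [mlist_length])) p)

/-- The Lie–Euler expression `E^I_σ(L)` of a function `L` on `J^r`, a function on `J^{2r}`. -/
noncomputable def LieEuler {r : ℕ} (σ : Fin m) (I : Fin n → ℕ) (L : Jet n m r → ℝ)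
    (p : Jet n m (2*r)) : ℝ :=
  ∑ J : MD n r,
    if h : (∑ i, (I i + J.1 i)) ≤ r then
      (-1:ℝ)^(∑ i, J.1 i) * (∏ i, (Nat.choose (I i + J.1 i) (I i) : ℝ)) *
        formalDI J.1 (pdY σ (fun i => I i + J.1 i) L)
          (projJet (by have := J.2; omega) p)
    else 0

/-- The Euler–Lagrange expression `E_σ(L)`. -/
noncomputable def EL {r : ℕ} (σ : Fin m) (L : Jet n m r → ℝ) : Jet n m (2*r) → ℝ :=
  LieEuler σ (fun _ => 0) L


/-! ### Infinite jets -/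

/-- Infinite jets. -/
abbrev JInf (n m : ℕ) : Type := (Fin n → ℝ) × (Fin m → (Fin n → ℕ) → ℝ)

/-- Projection of infinite jets to finite order, as a linear map. -/
def prInf (r : ℕ) : JInf n m →ₗ[ℝ] Jet n m r where
  toFun P := (P.1, fun q => P.2 q.1 q.2.1)
  map_add' _ _ := rfl
  map_smul' _ _ := rfl

lemma prInf_surj (r : ℕ) (p : Jet n m r) : ∃ P : JInf n m, prInf r P = p :=
  ⟨(p.1, fun σ J => yc σ J p), by
    refine Prod.ext rfl (funext fun q => ?_)
    have := q.2.2
    simp [prInf, yc, this]⟩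

lemma projJet_prInf {r s : ℕ} (h : r ≤ s) (P : JInf n m) :
    projJet h (prInf s P) = prInf r P := rfl

/-- The shift. -/
def shInf (i : Fin n) (P : JInf n m) : JInf n m := (0, fun σ J => P.2 σ (addE J i))

/-- The formal vector field. -/
def vInf (i : Fin n) (P : JInf n m) : JInf n m :=
  (Pi.single i 1, fun σ J => P.2 σ (addE J i))

lemma vInf_add_smul (i : Fin n) (P w : JInf n m) (t : ℝ) :
    vInf i (P + t • w) = vInf i P + t • shInf i w := by
  refine Prod.ext ?_ ?_
  · simp [vInf, shInf]
  · rfl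

lemma addE_comm (J : Fin n → ℕ) (i j : Fin n) : addE (addE J i) j = addE (addE J j) i := by
  funext k; simp only [addE]; omega

lemma shInf_vInf_comm (i j : Fin n) (P : JInf n m) :
    shInf i (vInf j P) = shInf j (vInf i P) := by
  refine Prod.ext rfl ?_
  funext σ J
  simp [shInf, vInf, addE_comm J i j]

/-- Vertical basis vector. -/
def eInf (σ : Fin m) (K : Fin n → ℕ) : JInf n m := (0, Pi.single σ (Pi.single K 1))

lemma addE_eq_iff (J K : Fin n → ℕ) (l : Fin n) (h : 1 ≤ K l) :
    addE J l = K ↔ J = subE K l := by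
  constructor
  · rintro rfl
    funext k; simp [addE, subE]
  · rintro rfl
    funext k; simp only [addE, subE]
    by_cases hk : k = l
    · subst hk; simp; omega
    · simp [hk]

lemma shInf_eInf (l : Fin n) (σ : Fin m) (K : Fin n → ℕ) :
    shInf l (eInf σ K) = if 1 ≤ K l then eInf σ (subE K l) else 0 := by
  split_ifs with h
  · refine Prod.ext rfl ?_
    funext τ J
    by_cases ht : τ = σ
    · subst ht
      simp [shInf, eInf, Pi.single_apply, addE_eq_iff J K l h]
    · simp [shInf, eInf, Pi.single_apply, ht]
  · refine Prod.ext rfl ?_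
    funext τ J
    have : addE J l ≠ K := by
      rintro rfl
      simp [addE] at h
    by_cases ht : τ = σ
    · subst ht
      simp [shInf, eInf, Pi.single_apply, this]
    · simp [shInf, eInf, Pi.single_apply, ht]

lemma prInf_eInf_of_le {r : ℕ} (σ : Fin m) (K : Fin n → ℕ) (h : (∑ i, K i) ≤ r) :
    prInf r (eInf σ K) = (0, Pi.single (σ, (⟨K, h⟩ : MD n r)) 1) := by
  refine Prod.ext rfl ?_
  funext q
  obtain ⟨τ, J, hJ⟩ := q
  by_cases ht : τ = σ
  · subst ht
    simp [prInf, eInf, Pi.single_apply]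
  · simp [prInf, eInf, Pi.single_apply, ht]

lemma prInf_eInf_of_not_le {r : ℕ} (σ : Fin m) (K : Fin n → ℕ) (h : ¬ (∑ i, K i) ≤ r) :
    prInf r (eInf σ K) = 0 := by
  refine Prod.ext rfl ?_
  funext q
  obtain ⟨τ, J, hJ⟩ := q
  have : J ≠ K := by rintro rfl; exact h hJ
  by_cases ht : τ = σ
  · subst ht
    simp [prInf, eInf, Pi.single_apply, this]
  · simp [prInf, eInf, Pi.single_apply, ht]

/-- Formal derivative on infinite jets. -/
noncomputable def DInf (i : Fin n) (F : JInf n m → ℝ) (P : JInf n m) : ℝ :=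
  lineDeriv ℝ F P (vInf i P)

/-- Vertical partial derivative on infinite jets. -/
noncomputable def YInf (σ : Fin m) (K : Fin n → ℕ) (F : JInf n m → ℝ) (P : JInf n m) : ℝ :=
  lineDeriv ℝ F P (eInf σ K)

/-- Iterated formal derivative. -/
noncomputable def DLInf : List (Fin n) → (JInf n m → ℝ) → (JInf n m → ℝ)
  | [], F => F
  | i :: l, F => DInf i (DLInf l F)

/-- Pullback to infinite jets. -/
def lift {r : ℕ} (f : Jet n m r → ℝ) : JInf n m → ℝ := fun P => f (prInf r P)

/-- Smooth functions of finite order. -/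
def Sm (F : JInf n m → ℝ) : Prop :=
  ∃ (r : ℕ) (f : Jet n m r → ℝ), ContDiff ℝ (⊤:ℕ∞) f ∧ F = lift f

lemma lineDeriv_lift {r : ℕ} {f : Jet n m r → ℝ} (hf : Differentiable ℝ f) (P w : JInf n m) :
    lineDeriv ℝ (lift f) P w = fderiv ℝ f (prInf r P) (prInf r w) := by
  rw [← (hf _).lineDeriv_eq_fderiv]
  simp only [lineDeriv, lift, map_add, map_smul]

/-- Formal vector field at finite level. -/
def vJet (i : Fin n) {r : ℕ} (p : Jet n m (r+1)) : Jet n m r :=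
  (Pi.single i 1, fun q => yc q.1 (addE q.2.1 i) p)

lemma sum_addE (J : Fin n → ℕ) (i : Fin n) : ∑ k, addE J i k = (∑ k, J k) + 1 := by
  simp [addE, Finset.sum_add_distrib]

lemma vJet_prInf (i : Fin n) {r : ℕ} (P : JInf n m) :
    vJet i (prInf (r+1) P) = prInf r (vInf i P) := by
  refine Prod.ext rfl ?_
  funext q
  have h : ∑ k, addE q.2.1 i k ≤ r + 1 := by rw [sum_addE]; have := q.2.2; omega
  simp [vJet, prInf, vInf, yc, h]

lemma formalD_eq (i : Fin n) {r : ℕ} (f : Jet n m r → ℝ) (p : Jet n m (r+1)) :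
    formalD i f p = fderiv ℝ f (projJet (Nat.le_succ r) p) (vJet i p) := by
  have hv : vJet i p = (Pi.single i 1, 0) + ∑ q : JIdx n m r,
      yc q.1 (addE q.2.1 i) p • ((0, Pi.single q 1) : Jet n m r) := by
    refine Prod.ext ?_ ?_
    · simp [vJet, Prod.fst_sum]
    · funext q
      simp [vJet, Prod.snd_sum, Finset.sum_apply, Pi.single_apply]
  rw [hv, map_add, map_sum]
  simp only [formalD, pdX, map_smul, smul_eq_mul]
  congr 1
  refine Finset.sum_congr rfl fun q _ => ?_
  rw [pdY, dif_pos q.2.2]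

lemma lift_formalD (i : Fin n) {r : ℕ} {f : Jet n m r → ℝ} (hf : Differentiable ℝ f) :
    lift (formalD i f) = DInf i (lift f) := by
  funext P
  rw [DInf, lineDeriv_lift hf, lift, formalD_eq, projJet_prInf, vJet_prInf]

lemma contDiff_projJet {r s : ℕ} (h : r ≤ s) :
    ContDiff ℝ (⊤:ℕ∞) (projJet h : Jet n m s → Jet n m r) := by
  unfold projJet
  fun_prop

lemma contDiff_vJet (i : Fin n) {r : ℕ} :
    ContDiff ℝ (⊤:ℕ∞) (vJet i : Jet n m (r+1) → Jet n m r) := by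
  unfold vJet
  refine contDiff_const.prodMk (contDiff_pi.2 fun q => ?_)
  unfold yc
  split_ifs <;> fun_prop

lemma contDiff_formalD (i : Fin n) {r : ℕ} {f : Jet n m r → ℝ} (hf : ContDiff ℝ (⊤:ℕ∞) f) :
    ContDiff ℝ (⊤:ℕ∞) (formalD i f) := by
  have : formalD i f = fun p => fderiv ℝ f (projJet (Nat.le_succ r) p) (vJet i p) :=
    funext (formalD_eq i f)
  rw [this]
  exact ((hf.fderiv_right (m := ((⊤:ℕ∞) : WithTop ℕ∞)) (by simp)).comp
    (contDiff_projJet _)).clm_apply (contDiff_vJet i)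

lemma contDiff_pdY (σ : Fin m) (K : Fin n → ℕ) {r : ℕ} {f : Jet n m r → ℝ}
    (hf : ContDiff ℝ (⊤:ℕ∞) f) : ContDiff ℝ (⊤:ℕ∞) (pdY σ K f) := by
  unfold pdY
  split_ifs
  · exact (hf.fderiv_right (m := ((⊤:ℕ∞) : WithTop ℕ∞)) (by simp)).clm_apply contDiff_const
  · exact contDiff_const

lemma cdiff {r : ℕ} {f : Jet n m r → ℝ} (hf : ContDiff ℝ (⊤:ℕ∞) f) : Differentiable ℝ f :=
  hf.differentiable (by simp)

lemma lift_pdY (σ : Fin m) (K : Fin n → ℕ) {r : ℕ} {f : Jet n m r → ℝ}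
    (hf : Differentiable ℝ f) : lift (pdY σ K f) = YInf σ K (lift f) := by
  funext P
  rw [YInf, lineDeriv_lift hf, lift, pdY]
  split_ifs with h
  · rw [prInf_eInf_of_le σ K h]
  · rw [prInf_eInf_of_not_le σ K h, map_zero]

lemma YInf_eq_zero (σ : Fin m) (K : Fin n → ℕ) {r : ℕ} {f : Jet n m r → ℝ}
    (hf : Differentiable ℝ f) (h : ¬ (∑ i, K i) ≤ r) : YInf σ K (lift f) = fun _ => 0 := by
  rw [← lift_pdY σ K hf]
  funext P
  simp [lift, pdY, h]

lemma contDiff_formalDL (l : List (Fin n)) {r : ℕ} {f : Jet n m r → ℝ}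
    (hf : ContDiff ℝ (⊤:ℕ∞) f) : ContDiff ℝ (⊤:ℕ∞) (formalDL l f) := by
  induction l with
  | nil => exact hf
  | cons i l ih => exact contDiff_formalD i ih

lemma lift_formalDL (l : List (Fin n)) {r : ℕ} {f : Jet n m r → ℝ}
    (hf : ContDiff ℝ (⊤:ℕ∞) f) : lift (formalDL l f) = DLInf l (lift f) := by
  induction l with
  | nil => rfl
  | cons i l ih =>
    have := lift_formalD i (cdiff (contDiff_formalDL l hf))
    rw [ih] at this
    exact this

lemma formalDI_prInf (I : Fin n → ℕ) {r : ℕ} {f : Jet n m r → ℝ}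
    (hf : ContDiff ℝ (⊤:ℕ∞) f) (P : JInf n m) :
    formalDI I f (prInf _ P) = DLInf (mlist I) (lift f) P := by
  rw [← lift_formalDL _ hf]
  rfl

lemma Sm.D {F : JInf n m → ℝ} (hF : Sm F) (i : Fin n) : Sm (DInf i F) := by
  obtain ⟨r, f, hf, rfl⟩ := hF
  exact ⟨_, _, contDiff_formalD i hf, (lift_formalD i (cdiff hf)).symm⟩

lemma Sm.DL {F : JInf n m → ℝ} (hF : Sm F) (l : List (Fin n)) : Sm (DLInf l F) := by
  induction l with
  | nil => exact hF
  | cons i l ih => exact ih.D i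

lemma Sm.Y {F : JInf n m → ℝ} (hF : Sm F) (σ : Fin m) (K : Fin n → ℕ) : Sm (YInf σ K F) := by
  obtain ⟨r, f, hf, rfl⟩ := hF
  exact ⟨_, _, contDiff_pdY σ K hf, (lift_pdY σ K (cdiff hf)).symm⟩

lemma Sm.zero : Sm (fun _ : JInf n m => (0:ℝ)) :=
  ⟨0, fun _ => 0, contDiff_const, rfl⟩

lemma Sm.exists_common {F G : JInf n m → ℝ} (hF : Sm F) (hG : Sm G) :
    ∃ (r : ℕ) (f g : Jet n m r → ℝ), ContDiff ℝ (⊤:ℕ∞) f ∧ ContDiff ℝ (⊤:ℕ∞) g ∧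
      F = lift f ∧ G = lift g := by
  obtain ⟨r, f, hf, rfl⟩ := hF
  obtain ⟨s, g, hg, rfl⟩ := hG
  exact ⟨max r s, f ∘ projJet (le_max_left _ _), g ∘ projJet (le_max_right _ _),
    hf.comp (contDiff_projJet _), hg.comp (contDiff_projJet _), rfl, rfl⟩

lemma DInf_add {F G : JInf n m → ℝ} (hF : Sm F) (hG : Sm G) (i : Fin n) :
    DInf i (fun P => F P + G P) = fun P => DInf i F P + DInf i G P := by
  obtain ⟨r, f, g, hf, hg, rfl, rfl⟩ := hF.exists_common hG
  have h : (fun P => lift f P + lift g P) = lift (m := m) (fun p => f p + g p) := rfl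
  funext P
  have hf' := cdiff hf
  have hg' := cdiff hg
  have hs : Differentiable ℝ (fun p => f p + g p) := hf'.add hg'
  rw [h, DInf, DInf, DInf, lineDeriv_lift hf', lineDeriv_lift hg', lineDeriv_lift hs,
    fderiv_fun_add (hf' _) (hg' _)]
  rfl

lemma Sm.add {F G : JInf n m → ℝ} (hF : Sm F) (hG : Sm G) : Sm (fun P => F P + G P) := by
  obtain ⟨r, f, g, hf, hg, rfl, rfl⟩ := hF.exists_common hG
  exact ⟨r, fun p => f p + g p, hf.add hg, rfl⟩

lemma DLInf_add {F G : JInf n m → ℝ} (hF : Sm F) (hG : Sm G) (l : List (Fin n)) :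
    DLInf l (fun P => F P + G P) = fun P => DLInf l F P + DLInf l G P := by
  induction l with
  | nil => rfl
  | cons i l ih =>
    simp only [DLInf]
    rw [ih, DInf_add (hF.DL l) (hG.DL l)]

lemma DLInf_zero (l : List (Fin n)) :
    DLInf l (fun _ : JInf n m => (0:ℝ)) = fun _ => 0 := by
  induction l with
  | nil => rfl
  | cons i l ih =>
    simp only [DLInf]
    rw [ih]
    funext P
    simp [DInf, lineDeriv]

lemma lineDeriv_DInf {r : ℕ} {f : Jet n m r → ℝ} (hf : ContDiff ℝ (⊤:ℕ∞) f) (i : Fin n)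
    (P w : JInf n m) :
    lineDeriv ℝ (DInf i (lift f)) P w =
      fderiv ℝ (fderiv ℝ f) (prInf r P) (prInf r w) (prInf r (vInf i P))
        + fderiv ℝ f (prInf r P) (prInf r (shInf i w)) := by
  have h2 : Differentiable ℝ (fderiv ℝ f) :=
    (hf.fderiv_right (m := ((⊤:ℕ∞) : WithTop ℕ∞)) (by simp)).differentiable (by simp)
  have hD : DInf i (lift f) = fun P => fderiv ℝ f (prInf r P) (prInf r (vInf i P)) := by
    funext P
    rw [DInf, lineDeriv_lift (cdiff hf)]
  rw [hD, lineDeriv]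
  simp only [vInf_add_smul, map_add, map_smul]
  have line : ∀ a b : Jet n m r, HasDerivAt (fun t : ℝ => a + t • b) b 0 := by
    intro a b
    simpa using ((hasDerivAt_id (0:ℝ)).smul_const b).const_add a
  have h3 : HasDerivAt (fun t : ℝ => fderiv ℝ f (prInf r P + t • prInf r w))
      (fderiv ℝ (fderiv ℝ f) (prInf r P) (prInf r w)) 0 := by
    refine HasFDerivAt.comp_hasDerivAt (0:ℝ) ?_ (line _ _)
    simpa using (h2 (prInf r P)).hasFDerivAt
  have h4 := h3.clm_apply (line (prInf r (vInf i P)) (prInf r (shInf i w)))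
  have h5 := h4.deriv
  simp only [zero_smul, add_zero, map_add, map_smul] at h5
  exact h5

lemma symm2 {r : ℕ} {f : Jet n m r → ℝ} (hf : ContDiff ℝ (⊤:ℕ∞) f) (p a b : Jet n m r) :
    fderiv ℝ (fderiv ℝ f) p a b = fderiv ℝ (fderiv ℝ f) p b a := by
  have h : IsSymmSndFDerivAt ℝ f p := by
    apply hf.contDiffAt.isSymmSndFDerivAt
    simp only [minSmoothness_of_isRCLikeNormedField]
    exact WithTop.coe_le_coe.2 le_top
  exact h a b

lemma DInf_comm {F : JInf n m → ℝ} (hF : Sm F) (i j : Fin n) :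
    DInf i (DInf j F) = DInf j (DInf i F) := by
  obtain ⟨r, f, hf, rfl⟩ := hF
  funext P
  rw [DInf, lineDeriv_DInf hf]
  conv_rhs => rw [DInf, lineDeriv_DInf hf]
  rw [symm2 hf, shInf_vInf_comm]

lemma DLInf_perm {F : JInf n m → ℝ} (hF : Sm F) {l l' : List (Fin n)} (h : l.Perm l') :
    DLInf l F = DLInf l' F := by
  induction h with
  | nil => rfl
  | cons i _ ih => simp only [DLInf, ih]
  | swap i j l => exact DInf_comm (hF.DL l) j i
  | trans _ _ h1 h2 => exact h1.trans h2

lemma DLInf_append (l l' : List (Fin n)) (F : JInf n m → ℝ) :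
    DLInf (l ++ l') F = DLInf l (DLInf l' F) := by
  induction l with
  | nil => rfl
  | cons i l ih => simp only [List.cons_append, DLInf, ih]

lemma count_mlist (J : Fin n → ℕ) (k : Fin n) : (mlist J).count k = J k := by
  rw [mlist, List.count_flatMap]
  have h : (List.count k ∘ fun i => List.replicate (J i) i)
      = fun i => if i = k then J i else 0 := by
    funext i
    simp [List.count_replicate]
  rw [h, ← Fin.sum_univ_def]
  simp

lemma DLInf_addE {F : JInf n m → ℝ} (hF : Sm F) (J : Fin n → ℕ) (l : Fin n) :
    DLInf (mlist J) (DInf l F) = DLInf (mlist (addE J l)) F := by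
  have : DInf l F = DLInf [l] F := rfl
  rw [this, ← DLInf_append]
  refine DLInf_perm hF (List.perm_iff_count.2 fun k => ?_)
  rw [List.count_append, count_mlist, count_mlist, addE, List.count_singleton]
  by_cases h : k = l
  · simp [h]
  · simp [h, Ne.symm h]

lemma YInf_DInf {F : JInf n m → ℝ} (hF : Sm F) (σ : Fin m) (K : Fin n → ℕ) (l : Fin n) :
    YInf σ K (DInf l F) =
      fun P => DInf l (YInf σ K F) P + (if 1 ≤ K l then YInf σ (subE K l) F P else 0) := by
  obtain ⟨r, f, hf, rfl⟩ := hF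
  funext P
  have h2 : Differentiable ℝ (fderiv ℝ f) :=
    (hf.fderiv_right (m := ((⊤:ℕ∞) : WithTop ℕ∞)) (by simp)).differentiable (by simp)
  have hY : YInf σ K (lift f) = lift (fun p => fderiv ℝ f p (prInf r (eInf σ K))) := by
    funext Q
    rw [YInf, lineDeriv_lift (cdiff hf), lift]
  have h3 : Differentiable ℝ (fun p => fderiv ℝ f p (prInf r (eInf σ K))) :=
    h2.clm_apply (differentiable_const _)
  rw [YInf, lineDeriv_DInf hf, shInf_eInf, hY, DInf, lineDeriv_lift h3,
    fderiv_clm_apply (h2 _) (differentiableAt_const _)]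
  simp only [fderiv_fun_const, Pi.zero_apply, ContinuousLinearMap.comp_zero, zero_add,
    ContinuousLinearMap.flip_apply]
  rw [symm2 hf]
  congr 1
  split_ifs
  · rw [YInf, lineDeriv_lift (cdiff hf)]
  · simp

/-- Coefficient. -/
noncomputable def cf (K J : Fin n → ℕ) : ℝ :=
  (-1:ℝ)^(∑ i, J i) * (∏ i, (Nat.choose (K i + J i) (K i) : ℝ))

lemma LieEuler_prInf {r : ℕ} (σ : Fin m) (K : Fin n → ℕ) {L : Jet n m r → ℝ}
    (hL : ContDiff ℝ (⊤:ℕ∞) L) (P : JInf n m) :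
    LieEuler σ K L (prInf _ P) =
      ∑' J : Fin n → ℕ, cf K J * DLInf (mlist J) (YInf σ (fun i => K i + J i) (lift L)) P := by
  have hz : ∀ J : Fin n → ℕ, ¬ (∑ i, (K i + J i)) ≤ r →
      cf K J * DLInf (mlist J) (YInf σ (fun i => K i + J i) (lift L)) P = 0 := by
    intro J hJ
    rw [YInf_eq_zero σ _ (cdiff hL) hJ, DLInf_zero, mul_zero]
  rw [← Function.Injective.tsum_eq (g := (Subtype.val : MD n r → (Fin n → ℕ)))
    Subtype.val_injective, tsum_fintype]
  · refine Finset.sum_congr rfl fun J _ => ?_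
    split_ifs with h
    · rw [projJet_prInf, formalDI_prInf _ (contDiff_pdY σ _ hL), lift_pdY σ _ (cdiff hL)]
      rfl
    · exact (hz _ h).symm
  · intro J hJ
    rw [Function.mem_support] at hJ
    have h : (∑ i, (K i + J i)) ≤ r := by
      by_contra h
      exact hJ (hz J h)
    rw [Finset.sum_add_distrib] at h
    exact ⟨⟨J, by omega⟩, rfl⟩

lemma subE_addE (J : Fin n → ℕ) (l : Fin n) : subE (addE J l) l = J := by
  funext k; simp [addE, subE]

lemma addE_subE (J : Fin n → ℕ) (l : Fin n) (h : 1 ≤ J l) : addE (subE J l) l = J :=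
  (addE_eq_iff _ _ _ h).2 rfl

lemma addE_inj (l : Fin n) : Function.Injective (fun J : Fin n → ℕ => addE J l) := by
  intro J J' h
  have := congrArg (fun J => subE J l) h
  simpa [subE_addE] using this

/-- Product splitting. -/
lemma cf_split (K J : Fin n → ℕ) (l : Fin n) :
    cf K J = (-1:ℝ)^(∑ i, J i) * ((Nat.choose (K l + J l) (K l) : ℝ) *
      ∏ i ∈ Finset.univ.erase l, (Nat.choose (K i + J i) (K i) : ℝ)) := by
  rw [cf, ← Finset.mul_prod_erase Finset.univ
    (fun i => (Nat.choose (K i + J i) (K i) : ℝ)) (Finset.mem_univ l)]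

lemma cf_addE (K J : Fin n → ℕ) (l : Fin n) :
    cf K (addE J l) = - ((-1:ℝ)^(∑ i, J i) * ((Nat.choose (K l + J l + 1) (K l) : ℝ) *
      ∏ i ∈ Finset.univ.erase l, (Nat.choose (K i + J i) (K i) : ℝ))) := by
  rw [cf_split K _ l, sum_addE, pow_succ]
  have : ∏ i ∈ Finset.univ.erase l, (Nat.choose (K i + addE J l i) (K i) : ℝ)
      = ∏ i ∈ Finset.univ.erase l, (Nat.choose (K i + J i) (K i) : ℝ) := by
    refine Finset.prod_congr rfl fun i hi => ?_
    simp [addE, Finset.ne_of_mem_erase hi]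
  rw [this]
  have h2 : K l + addE J l l = K l + J l + 1 := by simp [addE]; omega
  rw [h2]
  ring

lemma cf_subE (K J : Fin n → ℕ) (l : Fin n) :
    cf (subE K l) J = (-1:ℝ)^(∑ i, J i) * ((Nat.choose (K l - 1 + J l) (K l - 1) : ℝ) *
      ∏ i ∈ Finset.univ.erase l, (Nat.choose (K i + J i) (K i) : ℝ)) := by
  rw [cf_split _ _ l]
  have : ∏ i ∈ Finset.univ.erase l, (Nat.choose (subE K l i + J i) (subE K l i) : ℝ)
      = ∏ i ∈ Finset.univ.erase l, (Nat.choose (K i + J i) (K i) : ℝ) := by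
    refine Finset.prod_congr rfl fun i hi => ?_
    simp [subE, Finset.ne_of_mem_erase hi]
  rw [this]
  simp [subE]

lemma coeff_zero (K J : Fin n → ℕ) (l : Fin n) (hK : K l = 0) :
    (if 1 ≤ J l then cf K (subE J l) else 0) + (if 1 ≤ K l + J l then cf K J else 0) = 0 := by
  by_cases h : 1 ≤ J l
  · obtain ⟨J', rfl⟩ : ∃ J', J = addE J' l := ⟨_, (addE_subE J l h).symm⟩
    rw [if_pos h, if_pos (by omega), subE_addE, cf_addE, cf_split K J' l, hK]
    simp
  · rw [if_neg h, if_neg (by omega), add_zero]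

lemma coeff_pos (K J : Fin n → ℕ) (l : Fin n) (hK : 1 ≤ K l) :
    (if 1 ≤ J l then cf K (subE J l) else 0) + (if 1 ≤ K l + J l then cf K J else 0)
      = cf (subE K l) J := by
  rw [if_pos (show 1 ≤ K l + J l by omega)]
  by_cases h : 1 ≤ J l
  · obtain ⟨J', rfl⟩ : ∃ J', J = addE J' l := ⟨_, (addE_subE J l h).symm⟩
    rw [if_pos h, subE_addE]
    have h1 : cf (subE K l) (addE J' l) = _ := cf_addE (subE K l) J' l
    have h2 : ∏ i ∈ Finset.univ.erase l, (Nat.choose (subE K l i + J' i) (subE K l i) : ℝ)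
        = ∏ i ∈ Finset.univ.erase l, (Nat.choose (K i + J' i) (K i) : ℝ) := by
      refine Finset.prod_congr rfl fun i hi => ?_
      simp [subE, Finset.ne_of_mem_erase hi]
    have h3 : subE K l l = K l - 1 := by simp [subE]
    rw [h1, h2, h3, cf_addE, cf_split K J' l]
    obtain ⟨k, hk⟩ : ∃ k, K l = k + 1 := ⟨K l - 1, by omega⟩
    rw [hk, Nat.choose_succ_succ (k + 1 + J' l) k, Nat.add_sub_cancel,
      show k + J' l + 1 = k + 1 + J' l by omega]
    push_cast
    ring
  · have h0 : J l = 0 := by omega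
    rw [if_neg h, zero_add, cf_subE, cf_split K J l, h0]
    simp

lemma finite_bdd (r : ℕ) : {J : Fin n → ℕ | ∑ i, J i ≤ r}.Finite := by
  refine (Set.finite_range (Subtype.val : MD n r → (Fin n → ℕ))).subset ?_
  intro J hJ
  exact ⟨⟨J, hJ⟩, rfl⟩

lemma main_sum {r : ℕ} {f : Jet n m r → ℝ} (hf : ContDiff ℝ (⊤:ℕ∞) f)
    (l : Fin n) (σ : Fin m) (K : Fin n → ℕ) (P : JInf n m) :
    LieEuler σ K (formalD l f) (prInf _ P) =
      ∑' J : Fin n → ℕ, ((if 1 ≤ J l then cf K (subE J l) else 0)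
        + (if 1 ≤ K l + J l then cf K J else 0)) *
        DLInf (mlist J) (YInf σ (subE (fun i => K i + J i) l) (lift f)) P := by
  have hS : Sm (lift f) := ⟨r, f, hf, rfl⟩
  set T : (Fin n → ℕ) → ℝ := fun J =>
    DLInf (mlist J) (YInf σ (subE (fun i => K i + J i) l) (lift f)) P with hT
  have hTz : ∀ J, ¬ ∑ i, J i ≤ r + 1 → T J = 0 := by
    intro J hJ
    have : ¬ ∑ i, subE (fun i => K i + J i) l i ≤ r := by
      intro h
      have h2 : ∑ i, J i ≤ ∑ i, addE (subE (fun i => K i + J i) l) l i := by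
        refine Finset.sum_le_sum fun i _ => ?_
        simp only [addE, subE]; omega
      rw [sum_addE] at h2
      omega
    simp only [hT]
    rw [YInf_eq_zero σ _ (cdiff hf) this, DLInf_zero]
  have hsum : ∀ c : (Fin n → ℕ) → ℝ, Summable fun J => c J * T J := by
    intro c
    refine summable_of_finite_support ((finite_bdd (r+1)).subset ?_)
    intro J hJ
    by_contra h
    exact hJ (by simp [hTz J h])
  have hterm : ∀ J : Fin n → ℕ,
      cf K J * DLInf (mlist J) (YInf σ (fun i => K i + J i) (lift (formalD l f))) P
        = cf K J * T (addE J l) + (if 1 ≤ K l + J l then cf K J else 0) * T J := by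
    intro J
    have e1 : DLInf (mlist J) (DInf l (YInf σ (fun i => K i + J i) (lift f))) P
        = T (addE J l) := by
      rw [DLInf_addE (hS.Y _ _)]
      simp only [hT]
      congr 3
      rw [← subE_addE (fun i => K i + J i) l]
      congr 1
      funext k
      simp only [addE]; omega
    rw [lift_formalD l (cdiff hf), YInf_DInf hS]
    split_ifs with h
    · rw [DLInf_add ((hS.Y _ _).D l) (hS.Y _ _)]
      beta_reduce
      rw [e1]
      ring
    · rw [DLInf_add ((hS.Y _ _).D l) Sm.zero, DLInf_zero]
      beta_reduce
      rw [e1]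
      ring
  rw [LieEuler_prInf σ K (contDiff_formalD l hf), tsum_congr hterm]
  have hre : ∑' J, cf K J * T (addE J l)
      = ∑' J, (if 1 ≤ J l then cf K (subE J l) else 0) * T J := by
    rw [← (addE_inj l).tsum_eq
      (f := fun J => (if 1 ≤ J l then cf K (subE J l) else 0) * T J)]
    · refine tsum_congr fun J => ?_
      have : 1 ≤ addE J l l := by simp [addE]
      simp only [if_pos this, subE_addE]
    · intro J hJ
      have h : 1 ≤ J l := by
        by_contra h
        exact hJ (by simp only [if_neg h, zero_mul])
      exact ⟨subE J l, addE_subE J l h⟩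
  have hs1 : Summable fun J => cf K J * T (addE J l) := by
    refine summable_of_finite_support ((finite_bdd (r+1)).subset ?_)
    intro J hJ
    by_contra h
    refine hJ ?_
    have h' : ¬ ∑ i, addE J l i ≤ r + 1 := by
      rw [sum_addE]
      intro h2
      exact h (by change ∑ i, J i ≤ r + 1; omega)
    simp only [hTz _ h', mul_zero]
  rw [hs1.tsum_add (hsum _), hre, ← (hsum _).tsum_add (hsum _)]
  exact tsum_congr fun J => by ring

/-- the Lie–Euler operators on a formal derivative;
in particular the Euler–Lagrange expressions annihilate formal derivatives. -/
theorem lieEuler_formalDeriv (n m r : ℕ) (hn : 1 ≤ n) (hm : 1 ≤ m)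
    (f : Jet n m r → ℝ) (hf : ContDiff ℝ (⊤:ℕ∞) f)
    (l : Fin n) (σ : Fin m) (K : Fin n → ℕ) (hK : (∑ i, K i) ≤ r + 1) :
    (1 ≤ K l → ∀ p : Jet n m (2*(r+1)),
        LieEuler σ K (formalD l f) p
          = LieEuler σ (subE K l) f (projJet (by omega : 2*r ≤ 2*(r+1)) p)) ∧
    (K l = 0 → ∀ p : Jet n m (2*(r+1)), LieEuler σ K (formalD l f) p = 0) ∧
    (∀ p : Jet n m (2*(r+1)), EL σ (formalD l f) p = 0) := by
  have hz : ∀ K : Fin n → ℕ, K l = 0 → ∀ p : Jet n m (2*(r+1)),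
      LieEuler σ K (formalD l f) p = 0 := by
    intro K hK p
    obtain ⟨P, rfl⟩ := prInf_surj _ p
    rw [main_sum hf]
    simp [coeff_zero K _ l hK]
  refine ⟨fun h p => ?_, hz K, hz _ rfl⟩
  obtain ⟨P, rfl⟩ := prInf_surj _ p
  rw [main_sum hf, projJet_prInf, LieEuler_prInf σ _ hf]
  refine tsum_congr fun J => ?_
  rw [coeff_pos K J l h]
  congr 4
  funext k
  simp only [subE]
  by_cases hk : k = l
  · subst hk; simp; omega
  · simp [hk]

end JetVar
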